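/- arXiv:math/9903005 — 6 statements merged into one kernel-verified Lean document; each statement's English description precedes it below -/
import Mathlib

section
/- (The Generalized Liar Theorem) Let 𝒮 be an abstract formal system, A ⊆ F, B ⊆ S. Suppose 𝒮 is self-referential with respect to B and that ∼𝐀 (= N ∖ g*A) is B-representable. Then S ∩ A ≠ B; in fact there exists a sentence λ ∈ S with λ ∈ B if and only if λ ∉ A. -/
/-- An abstract formal system: expressions `E`, formulas `F`, sentences `S`,
names `Nm`, a naming bijection `g : F → Nm` (with inverse `ginv`), and a
substitution operation `sub`. -/
structure AbstractFormalSystem (α : Type*) where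
  E : Set α
  F : Set α
  S : Set α
  Nm : Set α
  S_nonempty : S.Nonempty
  S_subset_F : S ⊆ F
  F_subset_E : F ⊆ E
  F_disj_Nm : F ∩ Nm = ∅
  g : α → α
  ginv : α → α
  g_mem : ∀ φ ∈ F, g φ ∈ Nm
  ginv_mem : ∀ n ∈ Nm, ginv n ∈ F
  g_ginv : ∀ n ∈ Nm, g (ginv n) = n
  ginv_g : ∀ φ ∈ F, ginv (g φ) = φ
  g_injOn : Set.InjOn g F
  sub : α → α → α
  sub_mem : ∀ φ ∈ F, ∀ n ∈ Nm, sub φ n ∈ S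
  sub_sentence : ∀ σ ∈ S, ∀ n ∈ Nm, sub σ n = σ

namespace AbstractFormalSystem

variable {α : Type*}

/-- `φ` A-represents the set of names `X`. -/
def Represents (𝒮 : AbstractFormalSystem α) (A : Set α) (φ : α) (X : Set α) : Prop :=
  φ ∈ 𝒮.F ∧ ∀ n ∈ 𝒮.Nm, (n ∈ X ↔ 𝒮.sub φ n ∈ A)

/-- `X` is A-representable. -/
def Representable (𝒮 : AbstractFormalSystem α) (A : Set α) (X : Set α) : Prop :=
  ∃ φ, 𝒮.Represents A φ X

/-- `𝒮` is self-referential with respect to `A`. -/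
def SelfReferential (𝒮 : AbstractFormalSystem α) (A : Set α) : Prop :=
  ∀ X : Set α, X ⊆ 𝒮.Nm → 𝒮.Representable A X →
    𝒮.Representable A {n ∈ 𝒮.Nm | 𝒮.g (𝒮.sub (𝒮.ginv n) n) ∈ X}

end AbstractFormalSystem

open AbstractFormalSystem in
/-- **The Generalized Liar Theorem.** If `𝒮` is self-referential with respect to
`B` and `∼𝐀 = N ∖ g*A` is B-representable, then `S ∩ A ≠ B`, and in fact there
is a sentence `λ ∈ S` with `λ ∈ B ↔ λ ∉ A`. -/
theorem generalized_liar_theorem {α : Type*} (𝒮 : AbstractFormalSystem α)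
    (A B : Set α) (hA : A ⊆ 𝒮.F) (hB : B ⊆ 𝒮.S)
    (hsr : 𝒮.SelfReferential B)
    (hrep : 𝒮.Representable B (𝒮.Nm \ 𝒮.g '' A)) :
    𝒮.S ∩ A ≠ B ∧ ∃ l ∈ 𝒮.S, (l ∈ B ↔ l ∉ A) := by
  obtain ⟨φ, hφ, h⟩ := hsr _ Set.sdiff_subset hrep
  have hn := 𝒮.g_mem φ hφ
  have hl := 𝒮.sub_mem φ hφ _ hn
  have key : 𝒮.sub φ (𝒮.g φ) ∈ B ↔ 𝒮.sub φ (𝒮.g φ) ∉ A := by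
    rw [← h _ hn, Set.mem_sep_iff, 𝒮.ginv_g φ hφ, Set.mem_sdiff,
      𝒮.g_injOn.mem_image_iff hA (𝒮.S_subset_F hl)]
    exact ⟨fun H => H.2.2, fun H => ⟨hn, 𝒮.g_mem _ (𝒮.S_subset_F hl), H⟩⟩
  refine ⟨?_, _, hl, key⟩
  rintro rfl
  simp [hl] at key
end

section
/- (Arbitrarily long proofs) Let 𝒮 be an abstract formal system and let Pₙ ⊆ P ⊆ S be sets of sentences (Pₙ the sentences provable in fewer than n steps, P all provable sentences). Suppose 𝒮 is self-referential with respect to P and that ∼𝐏ₙ (= N ∖ g*Pₙ) is P-representable. Then P ∖ Pₙ ≠ ∅, i.e. there is a provable sentence not provable in fewer than n steps. -/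
open AbstractFormalSystem in
/-- **Arbitrarily long proofs.** If `Pₙ ⊆ P ⊆ S`, `𝒮` is self-referential with
respect to `P`, and `∼𝐏ₙ = N ∖ g*Pₙ` is P-representable, then `P ∖ Pₙ ≠ ∅`. -/
theorem arbitrarily_long_proofs {α : Type*} (𝒮 : AbstractFormalSystem α)
    (Pn P : Set α) (hPn : Pn ⊆ P) (hP : P ⊆ 𝒮.S)
    (hsr : 𝒮.SelfReferential P)
    (hrep : 𝒮.Representable P (𝒮.Nm \ 𝒮.g '' Pn)) :
    (P \ Pn).Nonempty := by
  obtain ⟨ψ, hψ, h⟩ := hsr _ Set.sdiff_subset hrep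
  have hg := 𝒮.g_mem ψ hψ
  have hσ := 𝒮.sub_mem ψ hψ _ hg
  have key : 𝒮.sub ψ (𝒮.g ψ) ∉ Pn ↔ 𝒮.sub ψ (𝒮.g ψ) ∈ P := by
    have hPnF : Pn ⊆ 𝒮.F := (hPn.trans hP).trans 𝒮.S_subset_F
    simpa [hg, 𝒮.ginv_g ψ hψ, 𝒮.g_mem _ (𝒮.S_subset_F hσ),
      𝒮.g_injOn.mem_image_iff hPnF (𝒮.S_subset_F hσ), -Set.mem_image] using h _ hg
  have hn : 𝒮.sub ψ (𝒮.g ψ) ∉ Pn := fun hmem => key.2 (hPn hmem) hmem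
  exact ⟨_, key.1 hn, hn⟩
end

section
/- (Abstract Gödel incompleteness theorem, syntactic form) Let 𝒮 be a logical system with respect to P and T. Suppose 𝒮 is self-referential with respect to P and that 𝐏 (= g*P) is P-representable. If 𝒮 is consistent, then 𝒮 is incomplete. -/
/-- A logical system: an abstract formal system together with distinguished
sets `P` (provable sentences) and `T` (true sentences) and a negation
operation `neg` on formulas. -/
structure LogicalSystem (α : Type*) extends AbstractFormalSystem α where
  P : Set α
  T : Set α
  P_subset_S : P ⊆ S
  T_subset_S : T ⊆ S
  neg : α → α
  neg_mem : ∀ φ ∈ F, neg φ ∈ F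
  neg_T : ∀ φ ∈ F, ∀ n ∈ Nm, (sub φ n ∈ T ↔ sub (neg φ) n ∉ T)
  neg_P : ∀ φ ∈ F, ∀ n ∈ Nm, (sub φ n ∈ P ↔ sub (neg (neg φ)) n ∈ P)
  neg_sub : ∀ φ ∈ F, ∀ n ∈ Nm, neg (sub φ n) = sub (neg φ) n

namespace LogicalSystem

variable {α : Type*}

/-- For `H ⊆ F`, `H' = {φ ∈ F : φ' ∈ H}`. -/
def negSet (𝒮 : LogicalSystem α) (H : Set α) : Set α :=
  {φ ∈ 𝒮.F | 𝒮.neg φ ∈ H}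

/-- `𝒮` is consistent if `P ∩ P' = ∅`. -/
def Consistent (𝒮 : LogicalSystem α) : Prop :=
  𝒮.P ∩ 𝒮.negSet 𝒮.P = ∅

/-- `𝒮` is complete if `S ⊆ P ∪ P'`. -/
def Complete (𝒮 : LogicalSystem α) : Prop :=
  𝒮.S ⊆ 𝒮.P ∪ 𝒮.negSet 𝒮.P

/-- `𝒮` is sound if `P ⊆ T`. -/
def Sound (𝒮 : LogicalSystem α) : Prop :=
  𝒮.P ⊆ 𝒮.T

end LogicalSystem

namespace AbstractFormalSystem

variable {α : Type*}

theorem g_mem_image_iff (𝒮 : AbstractFormalSystem α) {A : Set α} (hA : A ⊆ 𝒮.F) {φ : α}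
    (hφ : φ ∈ 𝒮.F) : 𝒮.g φ ∈ 𝒮.g '' A ↔ φ ∈ A :=
  𝒮.g_injOn.mem_image_iff hA hφ

/-- In a system self-referential with respect to `A`, the set of names of expressions outside `A`
is not `A`-representable. -/
theorem not_representable_diff_image (𝒮 : AbstractFormalSystem α) {A : Set α}
    (hsr : 𝒮.SelfReferential A) (hA : A ⊆ 𝒮.S) :
    ¬ 𝒮.Representable A (𝒮.Nm \ 𝒮.g '' A) := by
  intro h
  obtain ⟨ψ, hψ, hrep⟩ := hsr _ Set.sdiff_subset h
  have hm := 𝒮.g_mem ψ hψ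
  have hσ := 𝒮.S_subset_F (𝒮.sub_mem ψ hψ _ hm)
  have key := hrep _ hm
  simp only [Set.mem_ofPred_eq, Set.mem_sdiff, 𝒮.ginv_g ψ hψ, hm, 𝒮.g_mem _ hσ, true_and,
    𝒮.g_mem_image_iff (hA.trans 𝒮.S_subset_F) hσ] at key
  exact iff_not_self key.symm

end AbstractFormalSystem

namespace LogicalSystem

variable {α : Type*} {𝒮 : LogicalSystem α}

theorem neg_mem_P_iff (hcon : 𝒮.Consistent) (hcomp : 𝒮.Complete) {σ : α} (hσ : σ ∈ 𝒮.S) :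
    𝒮.neg σ ∈ 𝒮.P ↔ σ ∉ 𝒮.P := by
  constructor
  · intro hneg hP
    exact Set.eq_empty_iff_forall_notMem.mp hcon σ ⟨hP, 𝒮.S_subset_F hσ, hneg⟩
  · intro hP
    exact ((hcomp hσ).resolve_left hP).2

/-- In a consistent and complete system, the complement of a `P`-representable set of names is
`P`-representable. -/
theorem representable_diff (hcon : 𝒮.Consistent) (hcomp : 𝒮.Complete) {X : Set α}
    (hX : 𝒮.Representable 𝒮.P X) : 𝒮.Representable 𝒮.P (𝒮.Nm \ X) := by
  obtain ⟨φ, hφ, hrep⟩ := hX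
  refine ⟨𝒮.neg φ, 𝒮.neg_mem φ hφ, fun n hn => ?_⟩
  rw [← 𝒮.neg_sub φ hφ n hn, neg_mem_P_iff hcon hcomp (𝒮.sub_mem φ hφ n hn), ← hrep n hn]
  simp [hn]

end LogicalSystem

open LogicalSystem in
/-- **Abstract Gödel incompleteness theorem (syntactic form).** If `𝒮` is
self-referential with respect to `P` and `𝐏 = g*P` is P-representable, then
consistency implies incompleteness. -/
theorem abstract_goedel_syntactic {α : Type*} (𝒮 : LogicalSystem α)
    (hsr : 𝒮.toAbstractFormalSystem.SelfReferential 𝒮.P)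
    (hrep : 𝒮.toAbstractFormalSystem.Representable 𝒮.P (𝒮.g '' 𝒮.P))
    (hcon : 𝒮.Consistent) :
    ¬ 𝒮.Complete := by
  intro hcomp
  exact 𝒮.not_representable_diff_image hsr 𝒮.P_subset_S
    (representable_diff hcon hcomp hrep)
end

section
/- (Abstract Gödel incompleteness theorem, semantic form) Let 𝒮 be a logical system with respect to P and T. Suppose 𝒮 is self-referential with respect to T and that 𝐏 (= g*P) is T-representable. If 𝒮 is sound, then 𝒮 is incomplete. -/
open LogicalSystem in
/-- **Abstract Gödel incompleteness theorem (semantic form).** If `𝒮` is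
self-referential with respect to `T` and `𝐏 = g*P` is T-representable, then
soundness implies incompleteness. -/
theorem abstract_goedel_semantic {α : Type*} (𝒮 : LogicalSystem α)
    (hsr : 𝒮.toAbstractFormalSystem.SelfReferential 𝒮.T)
    (hrep : 𝒮.toAbstractFormalSystem.Representable 𝒮.T (𝒮.g '' 𝒮.P))
    (hsound : 𝒮.Sound) :
    ¬ 𝒮.Complete := by
  intro hcomplete
  have hP : 𝒮.g '' 𝒮.P ⊆ 𝒮.Nm := by
    rintro _ ⟨σ, hσ, rfl⟩
    exact 𝒮.g_mem σ (𝒮.S_subset_F (𝒮.P_subset_S hσ))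
  obtain ⟨ψ, hψ, hdiag⟩ := hsr _ hP hrep
  have hφ := 𝒮.neg_mem ψ hψ
  have hn := 𝒮.g_mem _ hφ
  have hσ := 𝒮.sub_mem _ hφ _ hn
  have hfix := hdiag _ hn
  simp only [Set.mem_ofPred_eq, hn, true_and, 𝒮.ginv_g _ hφ] at hfix
  rw [𝒮.g_injOn.mem_image_iff (𝒮.P_subset_S.trans 𝒮.S_subset_F) (𝒮.S_subset_F hσ),
    𝒮.neg_T ψ hψ _ hn] at hfix
  have hunprov : 𝒮.sub (𝒮.neg ψ) (𝒮.g (𝒮.neg ψ)) ∉ 𝒮.P := fun h => hfix.1 h (hsound h)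
  have htrue := not_not.1 (mt hfix.2 hunprov)
  rcases hcomplete hσ with h | ⟨-, h⟩
  · exact hunprov h
  · rw [𝒮.neg_sub _ hφ _ hn] at h
    exact (𝒮.neg_T _ hφ _ hn).1 htrue (hsound h)
end

section
/- (Abstract Tarski undefinability of truth) Let 𝒮 be a logical system with respect to P and T. If 𝒮 is self-referential with respect to T, then 𝐓 (= g*T) is not T-representable. -/
namespace AbstractFormalSystem

variable {α : Type*}

/-- Diagonal lemma: in a system self-referential with respect to `A`, every `A`-representable set of
names `X` has a sentence that lies in `A` exactly when its own name lies in `X`. -/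
theorem SelfReferential.exists_fixedPoint {𝒮 : AbstractFormalSystem α} {A X : Set α}
    (h : 𝒮.SelfReferential A) (hX : X ⊆ 𝒮.Nm) (hrep : 𝒮.Representable A X) :
    ∃ σ ∈ 𝒮.S, (σ ∈ A ↔ 𝒮.g σ ∈ X) := by
  obtain ⟨ψ, hψ, hrep⟩ := h X hX hrep
  have hn := 𝒮.g_mem ψ hψ
  refine ⟨𝒮.sub ψ (𝒮.g ψ), 𝒮.sub_mem ψ hψ _ hn, ?_⟩
  simpa [hn, 𝒮.ginv_g ψ hψ] using (hrep _ hn).symm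

end AbstractFormalSystem

namespace LogicalSystem

variable {α : Type*}

/-- `T`-representable sets are closed under complement in the set of names. -/
theorem representable_compl {𝒮 : LogicalSystem α} {X : Set α}
    (h : 𝒮.toAbstractFormalSystem.Representable 𝒮.T X) :
    𝒮.toAbstractFormalSystem.Representable 𝒮.T (𝒮.Nm \ X) := by
  obtain ⟨φ, hφ, hrep⟩ := h
  refine ⟨𝒮.neg φ, 𝒮.neg_mem φ hφ, fun n hn => ?_⟩
  have hneg := 𝒮.neg_T φ hφ n hn
  simp only [Set.mem_sdiff, hn, true_and, hrep n hn]
  tauto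

end LogicalSystem

open LogicalSystem in
/-- **Abstract Tarski undefinability of truth.** If `𝒮` is self-referential
with respect to `T`, then `𝐓 = g*T` is not T-representable. -/
theorem abstract_tarski {α : Type*} (𝒮 : LogicalSystem α)
    (hsr : 𝒮.toAbstractFormalSystem.SelfReferential 𝒮.T) :
    ¬ 𝒮.toAbstractFormalSystem.Representable 𝒮.T (𝒮.g '' 𝒮.T) := by
  intro h
  obtain ⟨σ, hσ, hiff⟩ := hsr.exists_fixedPoint Set.sdiff_subset (representable_compl h)
  have hσF := 𝒮.S_subset_F hσ
  have hTF : 𝒮.T ⊆ 𝒮.F := 𝒮.T_subset_S.trans 𝒮.S_subset_F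
  rw [Set.mem_sdiff, 𝒮.g_injOn.mem_image_iff hTF hσF] at hiff
  have hn := 𝒮.g_mem σ hσF
  tauto
end

section
/- (Abstract Church undecidability of provability) Let 𝒮 be a logical system with respect to P and T. If 𝒮 is self-referential with respect to P, then ∼𝐏 (= N ∖ g*P) is not P-representable. -/
open LogicalSystem in
/-- **Abstract Church undecidability of provability.** If `𝒮` is
self-referential with respect to `P`, then `∼𝐏 = N ∖ g*P` is not
P-representable. -/
theorem abstract_church {α : Type*} (𝒮 : LogicalSystem α)
    (hsr : 𝒮.toAbstractFormalSystem.SelfReferential 𝒮.P) :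
    ¬ 𝒮.toAbstractFormalSystem.Representable 𝒮.P (𝒮.Nm \ 𝒮.g '' 𝒮.P) := by
  intro h
  obtain ⟨φ, hφ, hrep⟩ := hsr _ Set.sdiff_subset h
  have hn := 𝒮.g_mem φ hφ
  have hS := 𝒮.sub_mem φ hφ _ hn
  have hiff := hrep _ hn
  have himage : 𝒮.g (𝒮.sub φ (𝒮.g φ)) ∈ 𝒮.g '' 𝒮.P ↔ 𝒮.sub φ (𝒮.g φ) ∈ 𝒮.P :=
    𝒮.g_injOn.mem_image_iff (𝒮.P_subset_S.trans 𝒮.S_subset_F) (𝒮.S_subset_F hS)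
  have hname := 𝒮.g_mem _ (𝒮.S_subset_F hS)
  simp only [Set.mem_ofPred_eq, Set.mem_sdiff, 𝒮.ginv_g φ hφ, himage, hn, hname, true_and] at hiff
  exact iff_not_self hiff.symm
end
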